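/- Let Λ' be a symbol with even defect, rank(Λ') = n' and Υ(Λ') = [μ'; λ'], set n = n' − μ'_1 − def(Λ')/2, and let Λ be a symbol with Υ(Λ) = [λ'; μ'²] and def(Λ) = −def(Λ') + 1 (so rank(Λ) = n). Then every symbol Λ'' with rank(Λ'') = n' and (Λ, Λ'') ∈ B^+_{n,n'} satisfies either Υ(Λ'') = [μ'; λ'] (so Λ'' is equivalent to Λ') or (Υ(Λ'')^*)_1 > μ'_1. -/

import Mathlib

namespace GGP

/-- A *symbol* `Λ = (A; B)`: an ordered pair of finite sets of natural numbers. -/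
structure Symbol where
  A : Finset ℕ
  B : Finset ℕ

namespace Symbol

/-- The rank of a symbol:
`rank(Λ) = Σ_{a∈A} a + Σ_{b∈B} b − ⌊((|A|+|B|−1)/2)²⌋ = Σ + Σ − ⌊(|A|+|B|−1)²/4⌋`. -/
def rank (Λ : Symbol) : ℤ :=
  (∑ a ∈ Λ.A, (a : ℤ)) + (∑ b ∈ Λ.B, (b : ℤ))
    - ((Λ.A.card : ℤ) + (Λ.B.card : ℤ) - 1) ^ 2 / 4

/-- The defect of a symbol: `def(Λ) = |A| − |B| ∈ ℤ`. -/
def defect (Λ : Symbol) : ℤ := (Λ.A.card : ℤ) - (Λ.B.card : ℤ)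

/-- The shift of a symbol: `(a_1,…,a_m; b_1,…,b_l) ↦ (a_1+1,…,a_m+1,0; b_1+1,…,b_l+1,0)`. -/
def shift (Λ : Symbol) : Symbol :=
  ⟨insert 0 (Λ.A.image (· + 1)), insert 0 (Λ.B.image (· + 1))⟩

/-- Equivalence of symbols: one is obtained from the other by finitely many shifts. -/
def Equiv (Λ M : Symbol) : Prop :=
  ∃ k l : ℕ, shift^[k] Λ = shift^[l] M

end Symbol

/-- The partition associated to a finite set `A = {a_1 > … > a_m}` of naturals:
the function sending the index `i` (0-based, so `i` stands for the (i+1)-st part)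
to `λ_{i+1} = a_{i+1} − (m − (i+1))`, with parts beyond the length equal to `0`. -/
def upsFun (A : Finset ℕ) : ℕ → ℕ := fun i =>
  if h : i < A.card then
    (A.sort (· ≤ ·))[A.card - 1 - i]'(by rw [Finset.length_sort]; omega)
      - (A.card - 1 - i)
  else 0

/-- `|λ|`: the sum of the parts of a partition (given as a function). -/
noncomputable def psize (f : ℕ → ℕ) : ℕ := ∑ᶠ i, f i

/-- The transpose of a partition: `(ᵗλ)_{i+1} = #{ j : λ_{j+1} ≥ i+1 }` (0-based index `i`). -/
noncomputable def transposeFun (f : ℕ → ℕ) : ℕ → ℕ := fun i => Set.ncard {j | i + 1 ≤ f j}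

/-- `λ ≼ μ` : `μ_i − 1 ≤ λ_i ≤ μ_i` for every `i`. -/
def Prec (f g : ℕ → ℕ) : Prop := ∀ i, g i - 1 ≤ f i ∧ f i ≤ g i

/-- `λ²`: the partition obtained from `λ` by deleting one copy of its largest part. -/
def tailPart (f : ℕ → ℕ) : ℕ → ℕ := fun i => f (i + 1)

/-- A function `ℕ → ℕ` represents a partition iff it is antitone and eventually zero. -/
def IsPartitionFun (f : ℕ → ℕ) : Prop :=
  Antitone f ∧ ∃ N, ∀ i, N ≤ i → f i = 0

/-- `(Λ, Λ') ∈ B^+_{n,n'}`. -/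
def BPlus (n n' : ℕ) (Λ Λ' : Symbol) : Prop :=
  Λ.rank = (n : ℤ) ∧ Λ'.rank = (n' : ℤ) ∧
    Prec (transposeFun (upsFun Λ'.B)) (transposeFun (upsFun Λ.A)) ∧
    Prec (transposeFun (upsFun Λ.B)) (transposeFun (upsFun Λ'.A)) ∧
    Λ'.defect = -Λ.defect + 1

/-- `(Λ, Λ') ∈ B^−_{n,n'}`. -/
def BMinus (n n' : ℕ) (Λ Λ' : Symbol) : Prop :=
  Λ.rank = (n : ℤ) ∧ Λ'.rank = (n' : ℤ) ∧
    Prec (transposeFun (upsFun Λ'.A)) (transposeFun (upsFun Λ.B)) ∧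
    Prec (transposeFun (upsFun Λ.A)) (transposeFun (upsFun Λ'.B)) ∧
    Λ'.defect = -Λ.defect - 1

/-- A symbol is reduced if not both rows contain `0`. -/
def Reduced (Λ : Symbol) : Prop := ¬ (0 ∈ Λ.A ∧ 0 ∈ Λ.B)


lemma upsFun_eq_zero {A : Finset ℕ} {i : ℕ} (h : A.card ≤ i) : upsFun A i = 0 := by
  simp [upsFun, Nat.not_lt.2 h]

lemma getElem_sort_add_le (A : Finset ℕ) (k d : ℕ) (h : k + d < (A.sort (· ≤ ·)).length) :
    (A.sort (· ≤ ·))[k] + d ≤ (A.sort (· ≤ ·))[k + d] := by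
  induction d with
  | zero => simp
  | succ d ih =>
    have h1 := ih (by omega)
    have h2 : (A.sort (· ≤ ·))[k + d] < (A.sort (· ≤ ·))[k + (d + 1)] :=
      A.sortedLT_sort.strictMono_get (a := ⟨k + d, by omega⟩) (b := ⟨k + (d + 1), h⟩)
        (Fin.mk_lt_mk.2 (by omega))
    omega

lemma upsFun_add (A : Finset ℕ) (k : ℕ) (h : k < (A.sort (· ≤ ·)).length) :
    upsFun A (A.card - 1 - k) + k = (A.sort (· ≤ ·))[k] := by
  have hk : k < A.card := by simpa using h
  have h0 := getElem_sort_add_le A 0 k (by omega)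
  simp only [Nat.zero_add] at h0
  have e : A.card - 1 - (A.card - 1 - k) = k := by omega
  rw [upsFun, dif_pos (by omega)]
  simp only [e]
  omega

lemma upsFun_antitone (A : Finset ℕ) : Antitone (upsFun A) := by
  refine antitone_nat_of_succ_le fun i => ?_
  by_cases h : i + 1 < A.card
  · have h1 := upsFun_add A (A.card - 1 - i) (by rw [Finset.length_sort]; omega)
    have h2 := upsFun_add A (A.card - 1 - (i + 1)) (by rw [Finset.length_sort]; omega)
    have h3 := getElem_sort_add_le A (A.card - 1 - (i + 1)) 1 (by rw [Finset.length_sort]; omega)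
    have e : A.card - 1 - (i + 1) + 1 = A.card - 1 - i := by omega
    simp only [e] at h3
    rw [show A.card - 1 - (A.card - 1 - i) = i by omega] at h1
    rw [show A.card - 1 - (A.card - 1 - (i + 1)) = i + 1 by omega] at h2
    omega
  · rw [upsFun_eq_zero (by omega)]
    exact Nat.zero_le _

/-- The set of `m` naturals whose associated partition is `f`. -/
def betaSet (m : ℕ) (f : ℕ → ℕ) : Finset ℕ :=
  (Finset.range m).image fun k => f (m - 1 - k) + k

lemma betaSet_upsFun (A : Finset ℕ) : betaSet A.card (upsFun A) = A := by
  ext a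
  rw [betaSet, Finset.mem_image, ← Finset.mem_sort (· ≤ ·), List.mem_iff_getElem]
  constructor
  · rintro ⟨k, hk, rfl⟩
    have hk' : k < (A.sort (· ≤ ·)).length := by simpa using hk
    exact ⟨k, hk', (upsFun_add A k hk').symm⟩
  · rintro ⟨k, hk, rfl⟩
    exact ⟨k, by simpa using hk, upsFun_add A k hk⟩

lemma shift_betaSet {m : ℕ} {f : ℕ → ℕ} (h : f m = 0) :
    insert 0 ((betaSet m f).image (· + 1)) = betaSet (m + 1) f := by
  rw [betaSet, betaSet, Finset.range_add_one', Finset.image_insert, Finset.image_image,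
    Finset.map_eq_image, Finset.image_image]
  congr 1
  · simp [h]
  · refine Finset.image_congr fun k _ => ?_
    have e : m + 1 - 1 - (k + 1) = m - 1 - k := by omega
    change f (m - 1 - k) + k + 1 = f (m + 1 - 1 - (k + 1)) + (k + 1)
    rw [e, Nat.add_assoc]

lemma Symbol.shift_iterate (Λ : Symbol) (k : ℕ) :
    Symbol.shift^[k] Λ =
      ⟨betaSet (Λ.A.card + k) (upsFun Λ.A), betaSet (Λ.B.card + k) (upsFun Λ.B)⟩ := by
  induction k with
  | zero => simp [betaSet_upsFun]
  | succ k ih =>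
    rw [Function.iterate_succ_apply', ih, Symbol.shift]
    simp only
    rw [shift_betaSet (upsFun_eq_zero (by omega)), shift_betaSet (upsFun_eq_zero (by omega))]
    rfl

lemma Symbol.equiv_of_upsFun_eq {Λ M : Symbol} (hA : upsFun Λ.A = upsFun M.A)
    (hB : upsFun Λ.B = upsFun M.B) (hd : Λ.defect = M.defect) : Λ.Equiv M := by
  refine ⟨M.A.card, Λ.A.card, ?_⟩
  unfold Symbol.defect at hd
  rw [Symbol.shift_iterate, Symbol.shift_iterate, hA, hB, Nat.add_comm Λ.A.card,
    show Λ.B.card + M.A.card = M.B.card + Λ.A.card by omega]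

lemma sum_eq_sum_upsFun_add (A : Finset ℕ) {N : ℕ} (hN : A.card ≤ N) :
    ∑ a ∈ A, a = ∑ i ∈ Finset.range N, upsFun A i + ∑ k ∈ Finset.range A.card, k := by
  have hinj : Set.InjOn (fun k => upsFun A (A.card - 1 - k) + k) (Finset.range A.card) := by
    rw [← Finset.card_image_iff]
    change (betaSet A.card (upsFun A)).card = _
    rw [betaSet_upsFun, Finset.card_range]
  have hsub : ∑ i ∈ Finset.range A.card, upsFun A i = ∑ i ∈ Finset.range N, upsFun A i :=
    Finset.sum_subset (Finset.range_mono hN) fun i _ hi =>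
      upsFun_eq_zero (by simpa using hi)
  calc ∑ a ∈ A, a = ∑ a ∈ betaSet A.card (upsFun A), a := by rw [betaSet_upsFun]
    _ = _ := by
      rw [betaSet, Finset.sum_image hinj, Finset.sum_add_distrib,
        Finset.sum_range_reflect (upsFun A), hsub]

lemma two_mul_sum_range_cast (m : ℕ) :
    2 * (∑ k ∈ Finset.range m, (k : ℤ)) = (m : ℤ) ^ 2 - m := by
  induction m with
  | zero => simp
  | succ m ih => rw [Finset.sum_range_succ, mul_add, ih]; push_cast; ring

lemma Symbol.rank_eq (Λ : Symbol) {N M : ℕ} (hN : Λ.A.card ≤ N) (hM : Λ.B.card ≤ M) :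
    Λ.rank = ((∑ i ∈ Finset.range N, upsFun Λ.A i : ℕ) : ℤ)
      + ((∑ i ∈ Finset.range M, upsFun Λ.B i : ℕ) : ℤ) + Λ.defect ^ 2 / 4 := by
  have hA := congrArg (Nat.cast : ℕ → ℤ) (sum_eq_sum_upsFun_add Λ.A hN)
  have hB := congrArg (Nat.cast : ℕ → ℤ) (sum_eq_sum_upsFun_add Λ.B hM)
  have gA := two_mul_sum_range_cast Λ.A.card
  have gB := two_mul_sum_range_cast Λ.B.card
  push_cast at hA hB ⊢
  rw [Symbol.rank, hA, hB]
  have hcA : (Λ.A.card : ℤ) = Λ.B.card + Λ.defect := by unfold Symbol.defect; ring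
  rw [hcA] at gA ⊢
  generalize (Λ.B.card : ℤ) = b at *
  rcases Int.even_or_odd' Λ.defect with ⟨e, he | he⟩
  · rw [he] at gA ⊢
    have h1 : (b + 2 * e + b - 1) ^ 2 / 4 = (b + e) ^ 2 - (b + e) := by
      rw [show (b + 2 * e + b - 1) ^ 2 = 1 + 4 * ((b + e) ^ 2 - (b + e)) by ring,
        Int.add_mul_ediv_left _ _ (by norm_num)]
      norm_num
    have h2 : (2 * e) ^ 2 / 4 = e ^ 2 := by
      rw [show (2 * e) ^ 2 = 4 * e ^ 2 by ring, Int.mul_ediv_cancel_left _ (by norm_num)]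
    rw [h1, h2]
    linarith
  · rw [he] at gA ⊢
    have h1 : (b + (2 * e + 1) + b - 1) ^ 2 / 4 = (b + e) ^ 2 := by
      rw [show (b + (2 * e + 1) + b - 1) ^ 2 = 4 * (b + e) ^ 2 by ring,
        Int.mul_ediv_cancel_left _ (by norm_num)]
    have h2 : (2 * e + 1) ^ 2 / 4 = e ^ 2 + e := by
      rw [show (2 * e + 1) ^ 2 = 1 + 4 * (e ^ 2 + e) by ring,
        Int.add_mul_ediv_left _ _ (by norm_num)]
      norm_num
    rw [h1, h2]
    linarith

lemma isPartitionFun_upsFun (A : Finset ℕ) : IsPartitionFun (upsFun A) :=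
  ⟨upsFun_antitone A, A.card, fun _ => upsFun_eq_zero⟩

lemma lt_transposeFun_iff {f : ℕ → ℕ} (hf : IsPartitionFun f) (i j : ℕ) :
    j < transposeFun f i ↔ i < f j := by
  obtain ⟨hanti, N, hN⟩ := hf
  have hex : ∃ n, f n ≤ i := ⟨N, by simp [hN N le_rfl]⟩
  have hset : {j | i + 1 ≤ f j} = Set.Iio (Nat.find hex) := by
    ext k
    simp only [Set.mem_ofPred_eq, Set.mem_Iio, Nat.lt_find_iff]
    refine ⟨fun h m hm => ?_, fun h => ?_⟩
    · have := hanti hm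
      omega
    · have := h k le_rfl
      omega
  have hcard : transposeFun f i = Nat.find hex := by
    rw [transposeFun, hset, ← Finset.coe_Iio, Set.ncard_coe_finset, Nat.card_Iio]
  rw [hcard, ← Set.mem_Iio, ← hset, Set.mem_ofPred_eq, Nat.succ_le_iff]

lemma Prec.le_of_transposeFun {f g : ℕ → ℕ} (hf : IsPartitionFun f) (hg : IsPartitionFun g)
    (h : Prec (transposeFun f) (transposeFun g)) (j : ℕ) : f j ≤ g j := by
  refine le_of_forall_lt fun i hi => ?_
  rw [← lt_transposeFun_iff hf] at hi
  rw [← lt_transposeFun_iff hg]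
  exact hi.trans_le (h i).2

lemma Prec.succ_le_of_transposeFun {f g : ℕ → ℕ} (hf : IsPartitionFun f)
    (hg : IsPartitionFun g) (h : Prec (transposeFun f) (transposeFun g)) (j : ℕ) :
    g (j + 1) ≤ f j := by
  refine le_of_forall_lt fun i hi => ?_
  rw [← lt_transposeFun_iff hg] at hi
  rw [← lt_transposeFun_iff hf]
  have := (h i).1
  omega

/-- Let `Λ'` have even defect, rank `n'`, `Υ(Λ') = [μ'; λ']`, let
`n = n' − μ'_1 − def(Λ')/2`, and let `Λ` satisfy `Υ(Λ) = [λ'; μ'²]` and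
`def(Λ) = −def(Λ')+1` (so `rank(Λ) = n`).  Then every symbol `Λ''` of rank `n'`
with `(Λ, Λ'') ∈ B^+_{n,n'}` satisfies either `Υ(Λ'') = [μ'; λ']` (and `Λ''` is
equivalent to `Λ'`) or `(Υ(Λ'')^*)_1 > μ'_1`. -/
theorem statement14 (Λ' Λ : Symbol) (heven : Even Λ'.defect) (n n' : ℕ)
    (hn' : Λ'.rank = (n' : ℤ))
    (hn : (n : ℤ) = (n' : ℤ) - (upsFun Λ'.A 0 : ℤ) - Λ'.defect / 2)
    (h1 : upsFun Λ.A = upsFun Λ'.B) (h2 : upsFun Λ.B = tailPart (upsFun Λ'.A))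
    (h3 : Λ.defect = -Λ'.defect + 1) :
    Λ.rank = (n : ℤ) ∧
    ∀ Λ'' : Symbol, BPlus n n' Λ Λ'' →
      (upsFun Λ''.A = upsFun Λ'.A ∧ upsFun Λ''.B = upsFun Λ'.B ∧
        Symbol.Equiv Λ'' Λ') ∨
      upsFun Λ'.A 0 < upsFun Λ''.A 0 := by
  obtain ⟨e, he⟩ := heven
  constructor
  · obtain ⟨N, hN⟩ : ∃ N, N = Λ'.A.card + Λ'.B.card + Λ.A.card + Λ.B.card := ⟨_, rfl⟩
    have r' := Λ'.rank_eq (N := N + 1) (M := N) (by omega) (by omega)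
    have r := Λ.rank_eq (N := N) (M := N) (by omega) (by omega)
    rw [Finset.sum_range_succ'] at r'
    rw [h1, h2] at r
    simp only [tailPart] at r
    have d' : Λ'.defect ^ 2 / 4 = e ^ 2 := by
      rw [he, show (e + e) ^ 2 = 4 * e ^ 2 by ring, Int.mul_ediv_cancel_left _ (by norm_num)]
    have d : Λ.defect ^ 2 / 4 = e ^ 2 - e := by
      rw [h3, he, show (-(e + e) + 1) ^ 2 = 1 + 4 * (e ^ 2 - e) by ring,
        Int.add_mul_ediv_left _ _ (by norm_num)]
      norm_num
    have d2 : Λ'.defect / 2 = e := by omega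
    rw [d'] at r'
    rw [d] at r
    push_cast at r r'
    linarith
  · rintro Λ'' ⟨-, hr, hB, hA, hd⟩
    refine or_iff_not_imp_right.2 fun h0 => ?_
    rw [not_lt] at h0
    have hdef : Λ''.defect = Λ'.defect := by rw [hd, h3]; ring
    rw [h1] at hB
    have hBle := hB.le_of_transposeFun (isPartitionFun_upsFun _) (isPartitionFun_upsFun _)
    have hAle : ∀ j, upsFun Λ''.A j ≤ upsFun Λ'.A j
      | 0 => h0
      | j + 1 => by
        have := hA.succ_le_of_transposeFun (isPartitionFun_upsFun _) (isPartitionFun_upsFun _) j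
        rwa [h2] at this
    obtain ⟨N, hN⟩ : ∃ N, N = Λ'.A.card + Λ'.B.card + Λ''.A.card + Λ''.B.card := ⟨_, rfl⟩
    have r' := Λ'.rank_eq (N := N) (M := N) (by omega) (by omega)
    have r'' := Λ''.rank_eq (N := N) (M := N) (by omega) (by omega)
    rw [hdef] at r''
    have sA := Finset.sum_le_sum fun i (_ : i ∈ Finset.range N) => hAle i
    have sB := Finset.sum_le_sum fun i (_ : i ∈ Finset.range N) => hBle i
    have eA := (Finset.sum_eq_sum_iff_of_le fun i _ => hAle i).1
      (show ∑ i ∈ Finset.range N, _ = _ by omega)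
    have eB := (Finset.sum_eq_sum_iff_of_le fun i _ => hBle i).1
      (show ∑ i ∈ Finset.range N, _ = _ by omega)
    have fA : upsFun Λ''.A = upsFun Λ'.A := by
      funext i
      by_cases hi : i < N
      · exact eA i (Finset.mem_range.2 hi)
      · rw [upsFun_eq_zero (by omega), upsFun_eq_zero (by omega)]
    have fB : upsFun Λ''.B = upsFun Λ'.B := by
      funext i
      by_cases hi : i < N
      · exact eB i (Finset.mem_range.2 hi)
      · rw [upsFun_eq_zero (by omega), upsFun_eq_zero (by omega)]
    exact ⟨fA, fB, Symbol.equiv_of_upsFun_eq fA fB hdef⟩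

end GGP
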